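/- arXiv:1203.0751 — 6 statements merged into one kernel-verified Lean document; each statement's English description precedes it below -/
import Mathlib

section
/- Claim 3.2: For any points x₁, …, x_𝔫 ∈ ℝ² with ‖x_j‖ > 1 for all j = 1, …, 𝔫, there exists a one-dimensional linear subspace L ⊆ ℝ² (depending on x₁, …, x_𝔫) such that (x_j + L) ∩ closedBall(0, 1/𝔫) = ∅ for every j = 1, …, 𝔫. -/
lemma sin_aux (α a : ℝ) (h0 : 0 < α) (h1 : α ≤ a) (h2 : a ≤ Real.pi - α) :
    Real.sin α ≤ Real.sin a := by
  have h := Real.sin_sub_sin a α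
  have s := Real.sin_nonneg_of_nonneg_of_le_pi (x := (a - α) / 2) (by linarith) (by linarith)
  have c := Real.cos_nonneg_of_neg_pi_div_two_le_of_le (x := (a + α) / 2) (by linarith)
    (by linarith)
  have := mul_nonneg s c
  linarith

/-- Two angles with small sine cannot differ by something between `2α` and `π - 2α`. -/
lemma two_aux (α a b s : ℝ) (h0 : 0 < α) (hs : s ≤ Real.sin α)
    (h1 : 2 * α ≤ b - a) (h2 : b - a ≤ Real.pi - 2 * α)
    (ha : |Real.sin a| < s) (hb : |Real.sin b| < s) : False := by
  have c1 : Real.cos (b - a) ≤ Real.cos (2 * α) :=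
    Real.cos_le_cos_of_nonneg_of_le_pi (by linarith) (by linarith) h1
  have c2 : -Real.cos (2 * α) ≤ Real.cos (b - a) := by
    rw [← Real.cos_pi_sub]
    exact Real.cos_le_cos_of_nonneg_of_le_pi (by linarith) (by linarith) h2
  have hA : |Real.cos (b - a)| ≤ Real.cos (2 * α) := abs_le.2 ⟨c2, c1⟩
  have hB := Real.abs_cos_le_one (b + a)
  have hP : Real.cos (b + a) * Real.cos (b - a) ≤ Real.cos (2 * α) := by
    refine (le_abs_self _).trans ?_
    rw [abs_mul]
    nlinarith [abs_nonneg (Real.cos (b - a))]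
  have e : Real.cos (b + a) * Real.cos (b - a) = 1 - Real.sin a ^ 2 - Real.sin b ^ 2 := by
    rw [Real.cos_add, Real.cos_sub]
    have := Real.sin_sq_add_cos_sq a
    have := Real.sin_sq_add_cos_sq b
    have ea : Real.cos a ^ 2 = 1 - Real.sin a ^ 2 := by linarith
    have eb : Real.cos b ^ 2 = 1 - Real.sin b ^ 2 := by linarith
    ring_nf
    rw [ea, eb]
    ring
  have e2 : Real.cos (2 * α) = 1 - 2 * Real.sin α ^ 2 := by
    rw [Real.cos_two_mul]
    have := Real.sin_sq_add_cos_sq α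
    linarith
  have a1 : Real.sin a ^ 2 < Real.sin α ^ 2 := by
    rw [← sq_abs (Real.sin a)]
    exact pow_lt_pow_left₀ (by linarith) (abs_nonneg _) (by norm_num)
  have b1 : Real.sin b ^ 2 < Real.sin α ^ 2 := by
    rw [← sq_abs (Real.sin b)]
    exact pow_lt_pow_left₀ (by linarith) (abs_nonneg _) (by norm_num)
  linarith

lemma angle_aux (n : ℕ) (hn : 0 < n) (φ : Fin n → ℝ) :
    ∃ θ : ℝ, ∀ j, 1 / (n : ℝ) ≤ |Real.sin (θ - φ j)| := by
  by_contra! H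
  have hn' : (0 : ℝ) < n := by exact_mod_cast hn
  have hpi := Real.pi_pos
  obtain ⟨α, hα⟩ : ∃ α : ℝ, α = Real.pi / (2 * n) := ⟨_, rfl⟩
  have hαn : 2 * α * n = Real.pi := by rw [hα]; field_simp
  have h0 : 0 < α := by rw [hα]; positivity
  have h1n : (1 : ℝ) ≤ n := by exact_mod_cast hn
  have hs : 1 / (n : ℝ) ≤ Real.sin α := by
    have := Real.mul_le_sin h0.le (by nlinarith)
    refine le_trans (le_of_eq ?_) this
    rw [hα]; field_simp
  choose f hf using fun k : Fin n => H (φ ⟨0, hn⟩ + α + 2 * α * (k : ℕ))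
  have key : ∀ k l : Fin n, k < l → f k ≠ f l := by
    intro k l hkl hfe
    have h1 := hf k
    have h2 := hf l
    rw [← hfe] at h2
    have q1 : ((k : ℕ) : ℝ) + 1 ≤ (l : ℕ) := by exact_mod_cast hkl
    have q2 : ((l : ℕ) : ℝ) + 1 ≤ n := by exact_mod_cast l.2
    have q3 : (0 : ℝ) ≤ (k : ℕ) := by positivity
    refine two_aux α _ _ _ h0 hs ?_ ?_ h1 h2 <;> nlinarith
  have inj : Function.Injective f := by
    intro k l h
    rcases lt_trichotomy k l with g | g | g
    · exact absurd h (key k l g)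
    · exact g
    · exact absurd h.symm (key l k g)
  obtain ⟨k, hk⟩ := (Finite.injective_iff_surjective.1 inj) ⟨0, hn⟩
  have h1 := hf k
  rw [hk] at h1
  have q2 : ((k : ℕ) : ℝ) + 1 ≤ n := by exact_mod_cast k.2
  have q3 : (0 : ℝ) ≤ (k : ℕ) := by positivity
  have := sin_aux α (φ ⟨0, hn⟩ + α + 2 * α * (k : ℕ) - φ ⟨0, hn⟩) h0 (by nlinarith) (by nlinarith)
  have := le_abs_self (Real.sin (φ ⟨0, hn⟩ + α + 2 * α * (k : ℕ) - φ ⟨0, hn⟩))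
  linarith

lemma polar_aux (p : EuclideanSpace ℝ (Fin 2)) :
    ∃ φ : ℝ, p 0 = ‖p‖ * Real.cos φ ∧ p 1 = ‖p‖ * Real.sin φ := by
  have hn : ‖p‖ = ‖(⟨p 0, p 1⟩ : ℂ)‖ := by
    rw [EuclideanSpace.norm_eq, Complex.norm_eq_sqrt_sq_add_sq]
    simp [Fin.sum_univ_two]
  refine ⟨Complex.arg ⟨p 0, p 1⟩, ?_, ?_⟩
  · rw [hn, Complex.norm_mul_cos_arg]
  · rw [hn, Complex.norm_mul_sin_arg]

/-- Claim 3.2: for points `x₁, …, x_𝔫 ∈ ℝ²` of norm `> 1` there is a line `L` through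
the origin such that `(x_j + L) ∩ closedBall(0, 1/𝔫) = ∅` for every `j`. -/
theorem claim_3_2 (𝔫 : ℕ) (x : Fin 𝔫 → EuclideanSpace ℝ (Fin 2))
    (hx : ∀ j, 1 < ‖x j‖) :
    ∃ L : Submodule ℝ (EuclideanSpace ℝ (Fin 2)), Module.finrank ℝ L = 1 ∧
      ∀ j, ((fun v => x j + v) '' (L : Set (EuclideanSpace ℝ (Fin 2)))) ∩
        Metric.closedBall 0 (1 / (𝔫 : ℝ)) = ∅ := by
  choose φ hφ0 hφ1 using fun j => polar_aux (x j)
  obtain ⟨θ, hθ⟩ : ∃ θ : ℝ, ∀ j, 1 / (𝔫 : ℝ) ≤ |Real.sin (θ - φ j)| := by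
    rcases Nat.eq_zero_or_pos 𝔫 with h | h
    · subst h
      exact ⟨0, fun j => j.elim0⟩
    · exact angle_aux 𝔫 h φ
  have hu : (!₂[Real.cos θ, Real.sin θ] : EuclideanSpace ℝ (Fin 2)) ≠ 0 := by
    intro h
    have h0 := congrArg (fun p : EuclideanSpace ℝ (Fin 2) => p 0) h
    have h1 := congrArg (fun p : EuclideanSpace ℝ (Fin 2) => p 1) h
    simp at h0 h1
    have := Real.sin_sq_add_cos_sq θ
    rw [h0, h1] at this
    norm_num at this
  refine ⟨Submodule.span ℝ {!₂[Real.cos θ, Real.sin θ]}, finrank_span_singleton hu, ?_⟩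
  intro j
  rw [Set.eq_empty_iff_forall_notMem]
  rintro p ⟨⟨v, hv, rfl⟩, hp⟩
  obtain ⟨t, rfl⟩ := Submodule.mem_span_singleton.1 hv
  rw [mem_closedBall_zero_iff] at hp
  have hpos : (0 : ℝ) < 1 / (𝔫 : ℝ) := by
    have : 0 < 𝔫 := Fin.pos j
    positivity
  obtain ⟨q, hq⟩ : ∃ q, q = x j + t • (!₂[Real.cos θ, Real.sin θ] : EuclideanSpace ℝ (Fin 2)) :=
    ⟨_, rfl⟩
  have hq0 : q 0 = x j 0 + t * Real.cos θ := by rw [hq]; simp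
  have hq1 : q 1 = x j 1 + t * Real.sin θ := by rw [hq]; simp
  have hp' : ‖q‖ ≤ 1 / (𝔫 : ℝ) := by rw [hq]; exact hp
  obtain ⟨ψ, hψ0, hψ1⟩ := polar_aux q
  have e1 : ‖q‖ * Real.sin (θ - ψ) = ‖x j‖ * Real.sin (θ - φ j) := by
    rw [Real.sin_sub, Real.sin_sub]
    have a0 : ‖q‖ * Real.cos ψ = ‖x j‖ * Real.cos (φ j) + t * Real.cos θ := by
      rw [← hψ0, hq0, ← hφ0]
    have a1 : ‖q‖ * Real.sin ψ = ‖x j‖ * Real.sin (φ j) + t * Real.sin θ := by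
      rw [← hψ1, hq1, ← hφ1]
    linear_combination Real.sin θ * a0 - Real.cos θ * a1
  have e2 := congrArg abs e1
  rw [abs_mul, abs_mul, abs_norm, abs_norm] at e2
  have b1 := Real.abs_sin_le_one (θ - ψ)
  have b2 := hθ j
  have b3 := hx j
  have c1 : ‖q‖ * |Real.sin (θ - ψ)| ≤ ‖q‖ := mul_le_of_le_one_right (norm_nonneg _) b1
  have c2 : |Real.sin (θ - φ j)| < ‖x j‖ * |Real.sin (θ - φ j)| :=
    lt_mul_of_one_lt_left (by linarith) b3
  linarith
end

section
/- For any unit vectors u₁, …, u_𝔫 ∈ ℝ² (‖u_j‖ = 1 for all j), there exists a unit vector x₀ ∈ ℝ² such that for every j = 1, …, 𝔫 the Euclidean distance from u_j to the line L = {t·x₀ : t ∈ ℝ} is at least sin(π/(2𝔫)). -/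
lemma aux_angle (v : EuclideanSpace ℝ (Fin 2)) (hv : ‖v‖ = 1) :
    ∃ a : ℝ, v 0 = Real.cos a ∧ v 1 = Real.sin a := by
  have h : v 0 ^ 2 + v 1 ^ 2 = 1 := by
    have := EuclideanSpace.real_norm_sq_eq v
    rw [hv, Fin.sum_univ_two] at this
    linarith
  have hz : ‖(⟨v 0, v 1⟩ : ℂ)‖ = 1 := by
    rw [Complex.norm_def, Complex.normSq_mk, Real.sqrt_eq_one]
    linarith
  refine ⟨Complex.arg ⟨v 0, v 1⟩, ?_, ?_⟩
  · rw [Complex.cos_arg (by intro h0; rw [h0] at hz; simp at hz), hz]; simp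
  · rw [Complex.sin_arg, hz]; simp

lemma aux_sin {r y : ℝ} (hr : 0 ≤ r) (h1 : r ≤ y) (h2 : y ≤ Real.pi - r) :
    Real.sin r ≤ Real.sin y := by
  rcases le_total y (Real.pi / 2) with h | h
  · exact Real.sin_le_sin_of_le_of_le_pi_div_two (by linarith [Real.pi_pos]) h h1
  · rw [← Real.sin_pi_sub y]
    exact Real.sin_le_sin_of_le_of_le_pi_div_two (by linarith [Real.pi_pos]) (by linarith)
      (by linarith)

lemma aux_arcsin (x r : ℝ) (hr0 : 0 ≤ r) (hr : r ≤ Real.pi / 2) (h : |Real.sin x| < Real.sin r) :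
    ∃ α, 0 ≤ α ∧ α < r ∧ |Real.sin x| = Real.sin α ∧ |Real.cos x| = Real.cos α := by
  refine ⟨Real.arcsin |Real.sin x|, Real.arcsin_nonneg.2 (abs_nonneg _), ?_, ?_, ?_⟩
  · rw [Real.arcsin_lt_iff_lt_sin' ⟨by linarith [Real.pi_pos], hr⟩]
    exact h
  · rw [Real.sin_arcsin (by linarith [abs_nonneg (Real.sin x)]) (Real.abs_sin_le_one x)]
  · rw [Real.cos_arcsin, sq_abs, Real.abs_cos_eq_sqrt_one_sub_sin_sq]

lemma aux_sub (x y r : ℝ) (hr0 : 0 ≤ r) (hr : r ≤ Real.pi / 4) (hx : |Real.sin x| < Real.sin r)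
    (hy : |Real.sin y| < Real.sin r) : |Real.sin (x - y)| < Real.sin (2 * r) := by
  obtain ⟨α, a0, a1, a2, a3⟩ := aux_arcsin x r hr0 (by linarith [Real.pi_pos]) hx
  obtain ⟨β, b0, b1, b2, b3⟩ := aux_arcsin y r hr0 (by linarith [Real.pi_pos]) hy
  calc |Real.sin (x - y)| ≤ Real.sin (α + β) := by
        rw [Real.sin_sub, Real.sin_add, ← a2, ← a3, ← b2, ← b3, ← abs_mul, ← abs_mul]
        exact abs_sub _ _
    _ < Real.sin (2 * r) :=
        Real.sin_lt_sin_of_lt_of_le_pi_div_two (by linarith [Real.pi_pos]) (by linarith)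
          (by linarith)

lemma aux_diff (n k k' : ℕ) (hk : k < n) (hkk : k' < k) (c a : ℝ)
    (h1 : |Real.sin (c + (2 * k + 1) * (Real.pi / (2 * n)) - a)| < Real.sin (Real.pi / (2 * n)))
    (h2 : |Real.sin (c + (2 * k' + 1) * (Real.pi / (2 * n)) - a)| < Real.sin (Real.pi / (2 * n))) :
    False := by
  have hn : (2 : ℝ) ≤ n := by exact_mod_cast (by omega : 2 ≤ n)
  have hp := Real.pi_pos
  set r := Real.pi / (2 * n) with hr
  have hrn : 2 * n * r = Real.pi := by rw [hr]; field_simp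
  have hr0 : 0 < r := by positivity
  have h := aux_sub _ _ r hr0.le (by nlinarith) h1 h2
  have e1 : (k' : ℝ) + 1 ≤ k := by exact_mod_cast hkk
  have e2 : (k : ℝ) + 1 ≤ n := by exact_mod_cast hk
  have e3 : (0 : ℝ) ≤ k' := by positivity
  have := aux_sin (r := 2 * r) (y := (c + (2 * k + 1) * r - a) - (c + (2 * k' + 1) * r - a))
    (by linarith) (by nlinarith) (by nlinarith)
  linarith [le_abs_self (Real.sin ((c + (2 * k + 1) * r - a) - (c + (2 * k' + 1) * r - a)))]

/-- For unit vectors `u₁, …, u_𝔫 ∈ ℝ²` there is a unit vector `x₀` such that every `u_j`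
is at distance at least `sin (π / (2𝔫))` from the line `L = ℝ·x₀`. -/
theorem dist_to_line_ge_sin (𝔫 : ℕ) (u : Fin 𝔫 → EuclideanSpace ℝ (Fin 2))
    (hu : ∀ j, ‖u j‖ = 1) :
    ∃ x₀ : EuclideanSpace ℝ (Fin 2), ‖x₀‖ = 1 ∧
      ∀ j, Real.sin (Real.pi / (2 * 𝔫)) ≤
        Metric.infDist (u j) {q : EuclideanSpace ℝ (Fin 2) | ∃ t : ℝ, q = t • x₀} := by
  choose a ha0 ha1 using fun j => aux_angle (u j) (hu j)
  have key : ∃ θ : ℝ, ∀ j, Real.sin (Real.pi / (2 * 𝔫)) ≤ |Real.sin (θ - a j)| := by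
    rcases Nat.eq_zero_or_pos 𝔫 with h0 | hpos
    · subst h0
      exact ⟨0, fun j => j.elim0⟩
    by_contra! hcon
    let j0 : Fin 𝔫 := ⟨0, hpos⟩
    choose f hf using fun k : Fin 𝔫 =>
      hcon (a j0 + (2 * ((k : ℕ) : ℝ) + 1) * (Real.pi / (2 * 𝔫)))
    have hinj : Function.Injective f := by
      intro k k' hkk
      by_contra hne
      have h1 := hf k
      have h2 := hf k'
      rw [hkk] at h1
      rcases lt_or_gt_of_ne (fun h => hne (Fin.ext h) : (k : ℕ) ≠ k') with h | h
      · exact aux_diff 𝔫 k' k k'.2 h _ _ h2 h1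
      · exact aux_diff 𝔫 k k' k.2 h _ _ h1 h2
    obtain ⟨k, hk⟩ := Finite.surjective_of_injective hinj j0
    have h := hf k
    rw [hk] at h
    have hp := Real.pi_pos
    have hn : (0 : ℝ) < 𝔫 := by exact_mod_cast hpos
    set r := Real.pi / (2 * 𝔫) with hr
    have hrn : 2 * 𝔫 * r = Real.pi := by rw [hr]; field_simp
    have hr0 : 0 < r := by positivity
    have e2 : ((k : ℕ) : ℝ) + 1 ≤ 𝔫 := by exact_mod_cast k.2
    have e3 : (0 : ℝ) ≤ ((k : ℕ) : ℝ) := by positivity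
    have := aux_sin (r := r) (y := a j0 + (2 * ((k : ℕ) : ℝ) + 1) * r - a j0) hr0.le
      (by nlinarith) (by nlinarith)
    linarith [le_abs_self (Real.sin (a j0 + (2 * ((k : ℕ) : ℝ) + 1) * r - a j0))]
  obtain ⟨θ, hθ⟩ := key
  refine ⟨!₂[Real.cos θ, Real.sin θ], ?_, fun j => (hθ j).trans ?_⟩
  · rw [EuclideanSpace.norm_eq, Fin.sum_univ_two]
    simp
  · rw [Metric.le_infDist (by exact ⟨_, 0, rfl⟩)]
    rintro q ⟨t, rfl⟩
    rw [dist_eq_norm]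
    refine abs_le_of_sq_le_sq ?_ (norm_nonneg _)
    rw [EuclideanSpace.real_norm_sq_eq, Fin.sum_univ_two]
    simp [ha0, ha1]
    rw [Real.sin_sub]
    have i1 := Real.sin_sq_add_cos_sq θ
    have i2 := Real.sin_sq_add_cos_sq (a j)
    generalize Real.sin θ = s at *
    generalize Real.cos θ = c at *
    generalize Real.sin (a j) = s' at *
    generalize Real.cos (a j) = c' at *
    have : (c' - t * c) ^ 2 + (s' - t * s) ^ 2 - (s * c' - c * s') ^ 2
        = (t - (c * c' + s * s')) ^ 2 := by
      linear_combination (t ^ 2 - s' ^ 2 - c' ^ 2) * i1 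
    nlinarith [sq_nonneg (t - (c * c' + s * s'))]
end

section
/- Let δ > 0, let 𝔫 ≥ 1 be an integer, and let x₁, …, x_𝔫 ∈ ℝ² satisfy ‖x_j‖ > δ for all j. Then there exist a one-dimensional linear subspace L ⊆ ℝ² and ε > 0 such that for every tuple (q₁, …, q_𝔫) of points of ℝ² with ‖q_j − x_j‖ < ε for all j, one has (q_j + L) ∩ closedBall(0, δ/𝔫) = ∅ for every j = 1, …, 𝔫. -/
lemma aux_sin_s7 (t : ℝ) (s : ℝ) (h : |Real.sin t| ≤ s) :
    haveI : Fact (0 < Real.pi) := ⟨Real.pi_pos⟩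
    ‖(t : AddCircle Real.pi)‖ ≤ Real.pi / 2 * s := by
  have hpi := Real.pi_pos
  rw [AddCircle.norm_eq]
  set k := round (Real.pi⁻¹ * t) with hk
  have h1 : |t - k * Real.pi| ≤ Real.pi / 2 := by
    have := abs_sub_round (Real.pi⁻¹ * t)
    rw [← hk] at this
    have e : t - k * Real.pi = (Real.pi⁻¹ * t - k) * Real.pi := by field_simp
    rw [e, abs_mul, abs_of_pos hpi]
    nlinarith
  have h2 : |Real.sin (t - k * Real.pi)| = |Real.sin t| := by
    rw [Real.sin_sub_int_mul_pi, abs_mul, abs_zpow]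
    simp
  have h3 := Real.mul_abs_le_abs_sin h1
  rw [h2] at h3
  have h4 : |t - k * Real.pi| = Real.pi / 2 * (2 / Real.pi * |t - k * Real.pi|) := by field_simp
  rw [h4]
  gcongr
  linarith

lemma aux_angle_s7 (n : ℕ) (hn : 1 ≤ n) (φ r : Fin n → ℝ) (h0 : ∀ j, 0 ≤ r j)
    (hr : ∀ j, r j < 1) : ∃ θ : ℝ, ∀ j, r j / n < |Real.sin (θ - φ j)| := by
  haveI : Fact (0 < Real.pi) := ⟨Real.pi_pos⟩
  have hpi := Real.pi_pos
  have hn0 : (0 : ℝ) < n := by exact_mod_cast hn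
  by_contra! hcon
  have hcov : (Set.univ : Set (AddCircle Real.pi)) ⊆
      ⋃ j ∈ (Finset.univ : Finset (Fin n)),
        Metric.closedBall ((φ j : ℝ) : AddCircle Real.pi) (Real.pi / 2 * (r j / n)) := by
    intro y _
    induction y using QuotientAddGroup.induction_on with
    | H θ =>
      obtain ⟨j, hj⟩ := hcon θ
      simp only [Set.mem_iUnion]
      refine ⟨j, Finset.mem_univ _, ?_⟩
      rw [mem_closedBall_iff_norm]
      exact aux_sin_s7 (θ - φ j) _ hj
  have hm := (MeasureTheory.measure_mono (μ := MeasureTheory.volume) hcov).trans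
    (MeasureTheory.measure_biUnion_finset_le _ _)
  rw [AddCircle.measure_univ] at hm
  have hle : ∑ j : Fin n, MeasureTheory.volume (Metric.closedBall ((φ j : ℝ) : AddCircle Real.pi)
      (Real.pi / 2 * (r j / n))) ≤ ∑ j : Fin n, ENNReal.ofReal (Real.pi * r j / n) := by
    refine Finset.sum_le_sum fun j _ => ?_
    rw [AddCircle.volume_closedBall]
    refine ENNReal.ofReal_le_ofReal ((min_le_right _ _).trans (le_of_eq ?_))
    ring
  have hm2 := hm.trans hle
  rw [← ENNReal.ofReal_sum_of_nonneg (fun j _ => by have := h0 j; positivity)] at hm2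
  have hlt : ∑ j : Fin n, Real.pi * r j / n < ∑ j : Fin n, Real.pi / n := by
    refine Finset.sum_lt_sum_of_nonempty ⟨⟨0, hn⟩, Finset.mem_univ _⟩ fun j _ => ?_
    have := hr j
    gcongr
    nlinarith
  have he : ∑ j : Fin n, Real.pi / n = Real.pi := by
    simp; field_simp
  rw [he] at hlt
  rw [ENNReal.ofReal_le_ofReal_iff (Finset.sum_nonneg fun j _ => by have := h0 j; positivity)] at hm2
  linarith

/-- A stable version of Claim 3.2: for `x₁, …, x_𝔫 ∈ ℝ²` with `‖x_j‖ > δ` there are a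
line `L` through the origin and `ε > 0` such that every tuple `(q_j)` with
`‖q_j − x_j‖ < ε` satisfies `(q_j + L) ∩ closedBall(0, δ/𝔫) = ∅` for every `j`. -/
theorem stable_claim_3_2 (δ : ℝ) (hδ : 0 < δ) (𝔫 : ℕ) (h𝔫 : 1 ≤ 𝔫)
    (x : Fin 𝔫 → EuclideanSpace ℝ (Fin 2)) (hx : ∀ j, δ < ‖x j‖) :
    ∃ (L : Submodule ℝ (EuclideanSpace ℝ (Fin 2))) (ε : ℝ),
      Module.finrank ℝ L = 1 ∧ 0 < ε ∧
      ∀ q : Fin 𝔫 → EuclideanSpace ℝ (Fin 2), (∀ j, ‖q j - x j‖ < ε) →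
        ∀ j, ((fun v => q j + v) '' (L : Set (EuclideanSpace ℝ (Fin 2)))) ∩
          Metric.closedBall 0 (δ / (𝔫 : ℝ)) = ∅ := by
  have hn0 : (0 : ℝ) < 𝔫 := by exact_mod_cast h𝔫
  have hpos : ∀ j, 0 < ‖x j‖ := fun j => hδ.trans (hx j)
  have hpol : ∀ j, ∃ φ : ℝ, x j 0 = ‖x j‖ * Real.cos φ ∧ x j 1 = ‖x j‖ * Real.sin φ := by
    intro j
    have hz : ‖(⟨x j 0, x j 1⟩ : ℂ)‖ = ‖x j‖ := by
      rw [EuclideanSpace.norm_eq, Complex.norm_eq_sqrt_sq_add_sq]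
      simp [Fin.sum_univ_two]
    refine ⟨Complex.arg ⟨x j 0, x j 1⟩, ?_, ?_⟩
    · rw [← hz, Complex.norm_mul_cos_arg]
    · rw [← hz, Complex.norm_mul_sin_arg]
  choose φ hc hs using hpol
  obtain ⟨θ, hθ⟩ := aux_angle_s7 𝔫 h𝔫 φ (fun j => δ / ‖x j‖) (fun j => by positivity)
    (fun j => (div_lt_one (hpos j)).2 (hx j))
  set f : EuclideanSpace ℝ (Fin 2) → ℝ := fun p => Real.sin θ * p 0 - Real.cos θ * p 1 with hf
  have hfle : ∀ p, |f p| ≤ ‖p‖ := by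
    intro p
    rw [EuclideanSpace.norm_eq]
    refine Real.abs_le_sqrt ?_
    simp only [hf, Fin.sum_univ_two, Real.norm_eq_abs, sq_abs]
    nlinarith [sq_nonneg (Real.cos θ * p 0 + Real.sin θ * p 1), Real.sin_sq_add_cos_sq θ,
      sq_nonneg (p 0), sq_nonneg (p 1)]
  have hfx : ∀ j, δ / 𝔫 < |f (x j)| := by
    intro j
    have h1 : f (x j) = ‖x j‖ * Real.sin (θ - φ j) := by
      simp only [hf]
      rw [hc, hs, Real.sin_sub]; ring
    rw [h1, abs_mul, abs_of_pos (hpos j)]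
    have h2 := mul_lt_mul_of_pos_left (hθ j) (hpos j)
    have h3 : ‖x j‖ * (δ / ‖x j‖ / 𝔫) = δ / 𝔫 := by
      have := (hpos j).ne'
      field_simp
    linarith
  haveI : Nonempty (Fin 𝔫) := ⟨⟨0, h𝔫⟩⟩
  obtain ⟨j0, hj0⟩ := Finite.exists_min (fun j => |f (x j)|)
  refine ⟨Submodule.span ℝ {!₂[Real.cos θ, Real.sin θ]}, |f (x j0)| - δ / 𝔫, ?_,
    sub_pos.2 (hfx j0), ?_⟩
  · refine finrank_span_singleton ?_
    intro h
    have h0 : Real.cos θ = 0 := by simpa using congrArg (fun v => v 0) h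
    have h1 : Real.sin θ = 0 := by simpa using congrArg (fun v => v 1) h
    have := Real.sin_sq_add_cos_sq θ
    rw [h0, h1] at this
    norm_num at this
  · intro q hq j
    rw [Set.eq_empty_iff_forall_notMem]
    rintro _ ⟨⟨v, hv, rfl⟩, hb⟩
    obtain ⟨c, rfl⟩ := Submodule.mem_span_singleton.1 hv
    rw [mem_closedBall_zero_iff] at hb
    have h1 := (hfle _).trans hb
    have h2 : f (q j + c • !₂[Real.cos θ, Real.sin θ]) = f (x j) + f (q j - x j) := by
      simp [hf]; ring
    simp only [h2] at h1
    have h3 := (hfle (q j - x j)).trans_lt (hq j)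
    have h4 := hj0 j
    have h5 := abs_sub_abs_le_abs_sub (f (x j)) (-f (q j - x j))
    rw [abs_neg, sub_neg_eq_add] at h5
    linarith
end

section
/- Claim 3.5 (first part): Let 𝔷 ⊆ S¹ be a finite nonempty subset and let δ > 0. Then the set Σ = {u = (u₁,u₂) ∈ ℂ² : ‖(Re(𝔳·u₁), Re(𝔳·u₂))‖ > δ for every 𝔳 ∈ 𝔷} is path-connected. -/
/-- The Euclidean norm on `ℝ²`. -/
noncomputable def eNorm2 (p : ℝ × ℝ) : ℝ :=
  Real.sqrt (p.1 ^ 2 + p.2 ^ 2)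

lemma aux_bound (δ p1 p2 r1 r2 : ℝ) (hD : p1 * r2 - p2 * r1 ≠ 0) :
    ∀ᶠ t : ℝ in Filter.atTop, ∀ a b : ℝ, a + b = 1 →
      δ ^ 2 < (a * (t * p1) + b * (t * r1)) ^ 2 + (a * (t * p2) + b * (t * r2)) ^ 2 := by
  set D := p1 * r2 - p2 * r1 with hDdef
  set N := p1 ^ 2 + p2 ^ 2 + r1 ^ 2 + r2 ^ 2 with hN
  have hD2 : 0 < D ^ 2 := by positivity
  have hN0 : 0 ≤ N := by positivity
  have key : ∀ a b : ℝ, a + b = 1 →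
      D ^ 2 ≤ 2 * N * ((a * p1 + b * r1) ^ 2 + (a * p2 + b * r2) ^ 2) := by
    intro a b hab
    set q1 := a * p1 + b * r1 with hq1
    set q2 := a * p2 + b * r2 with hq2
    have h1 : (a * D) ^ 2 ≤ (q1 ^ 2 + q2 ^ 2) * (r1 ^ 2 + r2 ^ 2) := by
      have : a * D = q1 * r2 - q2 * r1 := by rw [hq1, hq2, hDdef]; ring
      rw [this]; nlinarith [sq_nonneg (q1 * r1 + q2 * r2)]
    have h2 : (b * D) ^ 2 ≤ (q1 ^ 2 + q2 ^ 2) * (p1 ^ 2 + p2 ^ 2) := by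
      have : b * D = p1 * q2 - p2 * q1 := by rw [hq1, hq2, hDdef]; ring
      rw [this]; nlinarith [sq_nonneg (q1 * p1 + q2 * p2)]
    have h3 : D = a * D + b * D := by rw [← add_mul, hab, one_mul]
    have h4 : D ^ 2 ≤ 2 * ((a * D) ^ 2 + (b * D) ^ 2) := by
      have : D ^ 2 = (a * D + b * D) ^ 2 := by rw [← h3]
      rw [this]; nlinarith [sq_nonneg (a * D - b * D)]
    rw [hN]; nlinarith
  filter_upwards [Filter.eventually_ge_atTop 1,
    Filter.eventually_gt_atTop (2 * N * δ ^ 2 / D ^ 2)] with t ht1 ht a b hab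
  have hk := key a b hab
  rw [div_lt_iff₀ hD2] at ht
  set Q := (a * p1 + b * r1) ^ 2 + (a * p2 + b * r2) ^ 2 with hQ
  have e : (a * (t * p1) + b * (t * r1)) ^ 2 + (a * (t * p2) + b * (t * r2)) ^ 2 = t ^ 2 * Q := by
    rw [hQ]; ring
  rw [e]
  have h5 : t * D ^ 2 ≤ t ^ 2 * D ^ 2 := by
    apply mul_le_mul_of_nonneg_right _ hD2.le; nlinarith
  have h6 : t ^ 2 * D ^ 2 ≤ t ^ 2 * (2 * N * Q) := mul_le_mul_of_nonneg_left hk (sq_nonneg t)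
  have h7 : 2 * N * δ ^ 2 < 2 * N * (t ^ 2 * Q) := by linarith
  exact lt_of_mul_lt_mul_left h7 (by positivity)

/-- Determinant functional. -/
noncomputable def detF (v : ℂ) (u : ℂ × ℂ) : Module.Dual ℝ (ℂ × ℂ) where
  toFun w := (v * u.1).re * (v * w.2).re - (v * u.2).re * (v * w.1).re
  map_add' x y := by simp; ring
  map_smul' c x := by simp; ring

lemma detF_ne (v : ℂ) (hv : ‖v‖ = 1) (u : ℂ × ℂ)
    (h : 0 < (v * u.1).re ^ 2 + (v * u.2).re ^ 2) : ∃ w, detF v u w ≠ 0 := by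
  have hc : v.re ^ 2 + v.im ^ 2 = 1 := by
    have := Complex.sq_norm v
    rw [hv, Complex.normSq_apply] at this; linarith
  refine ⟨((-(v * u.2).re : ℝ) • star v, ((v * u.1).re : ℝ) • star v), ?_⟩
  generalize hA : (v * u.1).re = A at *
  generalize hB : (v * u.2).re = B at *
  have : detF v u ((-B : ℝ) • star v, (A : ℝ) • star v) = (A ^ 2 + B ^ 2) * (v.re ^ 2 + v.im ^ 2) := by
    change (v * u.1).re * (v * (A • star v)).re - (v * u.2).re * (v * ((-B) • star v)).re = _
    rw [hA, hB]; simp; ring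
  rw [this, hc]; linarith

theorem claim_3_5_first
    (𝔷 : Finset ℂ) (h𝔷 : (𝔷 : Set ℂ) ⊆ Metric.sphere (0 : ℂ) 1)
    (h𝔷ne : 𝔷.Nonempty) (δ : ℝ) (hδ : 0 < δ) :
    IsPathConnected {u : ℂ × ℂ |
      ∀ 𝔳 ∈ 𝔷, eNorm2 ((𝔳 * u.1).re, (𝔳 * u.2).re) > δ} := by
  have hv1 : ∀ v ∈ 𝔷, ‖v‖ = 1 := fun v hv => by simpa using h𝔷 hv
  have hS : {u : ℂ × ℂ | ∀ 𝔳 ∈ 𝔷, eNorm2 ((𝔳 * u.1).re, (𝔳 * u.2).re) > δ} =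
      {u : ℂ × ℂ | ∀ v ∈ 𝔷, δ ^ 2 < (v * u.1).re ^ 2 + (v * u.2).re ^ 2} := by
    ext u
    simp only [Set.mem_ofPred_eq, eNorm2, gt_iff_lt, Real.lt_sqrt hδ.le]
  rw [hS]
  set S := {u : ℂ × ℂ | ∀ v ∈ 𝔷, δ ^ 2 < (v * u.1).re ^ 2 + (v * u.2).re ^ 2} with hSd
  have hre : ∀ (v z w : ℂ) (a b : ℝ), (v * (a • z + b • w)).re =
      a * (v * z).re + b * (v * w).re := by
    intro v z w a b; simp; ring
  have hre1 : ∀ (v z : ℂ) (a : ℝ), (v * (a • z)).re = a * (v * z).re := by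
    intro v z a; simp; ring
  have hpos : ∀ u ∈ S, ∀ v ∈ 𝔷, 0 < (v * u.1).re ^ 2 + (v * u.2).re ^ 2 :=
    fun u hu v hv => lt_of_le_of_lt (sq_nonneg δ) (hu v hv)
  have hscale : ∀ u ∈ S, ∀ t : ℝ, 1 ≤ t → JoinedIn S u (t • u) := by
    intro u hu t ht
    apply JoinedIn.of_segment_subset
    rintro _ ⟨a, b, ha, hb, hab, rfl⟩ v hv
    have h1 := hu v hv
    have h2 := hpos u hu v hv
    simp only [Prod.fst_add, Prod.snd_add, Prod.smul_fst, Prod.smul_snd, hre, hre1]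
    have hs : 1 ≤ a + b * t := by nlinarith
    have hs2 : 1 ≤ (a + b * t) ^ 2 := by nlinarith
    calc δ ^ 2 < _ := h1
      _ ≤ (a + b * t) ^ 2 * ((v * u.1).re ^ 2 + (v * u.2).re ^ 2) :=
        le_mul_of_one_le_left h2.le hs2
      _ = _ := by ring
  rw [isPathConnected_iff]
  constructor
  · refine ⟨(((δ + 1 : ℝ) : ℂ), ((δ + 1 : ℝ) : ℂ) * Complex.I), fun v hv => ?_⟩
    have hc : v.re ^ 2 + v.im ^ 2 = 1 := by
      have := Complex.sq_norm v
      rw [hv1 v hv, Complex.normSq_apply] at this; linarith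
    have e : (v * ((δ + 1 : ℝ) : ℂ)).re ^ 2 + (v * (((δ + 1 : ℝ) : ℂ) * Complex.I)).re ^ 2
        = (v.re ^ 2 + v.im ^ 2) * (δ + 1) ^ 2 := by
      rw [Complex.mul_re, Complex.mul_re, Complex.mul_I_re, Complex.mul_I_im,
        Complex.ofReal_re, Complex.ofReal_im]; ring
    change δ ^ 2 < (v * ((δ + 1 : ℝ) : ℂ)).re ^ 2 + (v * (((δ + 1 : ℝ) : ℂ) * Complex.I)).re ^ 2
    rw [e, hc]; nlinarith
  · intro x hx y hy
    obtain ⟨w, hw⟩ := Module.Dual.exists_forall_ne_zero_of_forall_exists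
      (fun i : {v // v ∈ 𝔷} × Bool => detF i.1.1 (if i.2 then x else y)) (by
        rintro ⟨⟨v, hv⟩, b⟩
        apply detF_ne v (hv1 v hv)
        cases b
        · exact hpos y hy v hv
        · exact hpos x hx v hv)
    have hev : ∀ u : ℂ × ℂ, (∀ v ∈ 𝔷, detF v u w ≠ 0) →
        ∀ᶠ t : ℝ in Filter.atTop, JoinedIn S (t • u) (t • w) := by
      intro u hu
      have : ∀ᶠ t : ℝ in Filter.atTop, ∀ v ∈ 𝔷, ∀ a b : ℝ, a + b = 1 →
          δ ^ 2 < (a * (t * (v * u.1).re) + b * (t * (v * w.1).re)) ^ 2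
            + (a * (t * (v * u.2).re) + b * (t * (v * w.2).re)) ^ 2 := by
        rw [Filter.eventually_all_finset]
        intro v hv
        exact aux_bound δ _ _ _ _ (hu v hv)
      filter_upwards [this] with t ht
      apply JoinedIn.of_segment_subset
      rintro _ ⟨a, b, ha, hb, hab, rfl⟩ v hv
      simp only [Prod.fst_add, Prod.snd_add, Prod.smul_fst, Prod.smul_snd, hre, hre1]
      exact ht v hv a b hab
    obtain ⟨t, ht1, htx, hty⟩ := ((Filter.eventually_ge_atTop (1 : ℝ)).and
      ((hev x fun v hv => hw (⟨v, hv⟩, true)).and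
        (hev y fun v hv => by simpa using hw (⟨v, hv⟩, false)))).exists
    exact (((hscale x hx t ht1).trans htx).trans hty.symm).trans (hscale y hy t ht1).symm
end

section
/- Claim 3.5 (second part): Let 𝔷 ⊆ S¹ be a finite nonempty subset, let δ > 0, and set Σ = {u = (u₁,u₂) ∈ ℂ² : ‖(Re(𝔳·u₁), Re(𝔳·u₂))‖ > δ for every 𝔳 ∈ 𝔷}. Then for any points v, w ∈ ℂ³ with (v₁,v₂) ∈ Σ and (w₁,w₂) ∈ Σ, there exists a smooth (infinitely differentiable) curve c = (c₁,c₂,c₃) : [0,1] → ℂ³ with c(0) = v, c(1) = w, such that (c₁(t), c₂(t)) ∈ Σ for all t ∈ [0,1], and for all t ∈ [0,1] the derivative c′(t) is a nonzero null vector, i.e. c₁′(t)² + c₂′(t)² + c₃′(t)² = 0 and c′(t) ≠ (0,0,0). -/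
/-- Exponential monomials. -/
noncomputable def ee (n : ℤ) (t : ℝ) : ℂ := Complex.exp (2 * Real.pi * Complex.I * n * t)

/-- Trigonometric polynomials. -/
inductive TP : (ℝ → ℂ) → Prop
  | mono (n : ℤ) (c : ℂ) : TP (fun t => c * ee n t)
  | add (f g : ℝ → ℂ) : TP f → TP g → TP (fun t => f t + g t)

lemma ee_add (m n : ℤ) (t : ℝ) : ee (m + n) t = ee m t * ee n t := by
  unfold ee
  rw [← Complex.exp_add]; congr 1; push_cast; ring

lemma ee_zero (t : ℝ) : ee 0 t = 1 := by simp [ee]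

lemma ee_at_zero (n : ℤ) : ee n 0 = 1 := by simp [ee]

lemma ee_at_one (n : ℤ) : ee n 1 = 1 := by
  unfold ee
  rw [Complex.exp_eq_one_iff]
  exact ⟨n, by push_cast; ring⟩

lemma ee_norm (n : ℤ) (t : ℝ) : ‖ee n t‖ = 1 := by
  unfold ee
  rw [show (2 * Real.pi * Complex.I * n * t : ℂ) = ((2 * Real.pi * n * t : ℝ) : ℂ) * Complex.I by
    push_cast; ring]
  exact Complex.norm_exp_ofReal_mul_I _

lemma ee_deriv (n : ℤ) (t : ℝ) :
    HasDerivAt (ee n) (2 * Real.pi * Complex.I * n * ee n t) t := by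
  have := hasDerivAt_fourier (1 : ℝ) n t
  simp only [fourier_coe_apply, Complex.ofReal_one, div_one] at this
  exact this

lemma ee_contDiff (n : ℤ) : ContDiff ℝ (⊤ : ℕ∞) (ee n) := by
  unfold ee
  have : ContDiff ℝ (⊤ : ℕ∞) (fun t : ℝ => (t : ℂ)) := Complex.ofRealCLM.contDiff
  fun_prop

lemma TP.const (c : ℂ) : TP (fun _ => c) := by
  have := TP.mono 0 c
  simpa [ee_zero] using this

lemma TP.congr {f g : ℝ → ℂ} (h : TP f) (e : ∀ t, f t = g t) : TP g := by
  have : f = g := funext e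
  rwa [← this]

lemma TP.mul_mono {f : ℝ → ℂ} (h : TP f) (n : ℤ) (c : ℂ) : TP (fun t => f t * (c * ee n t)) := by
  induction h with
  | mono m d => exact (TP.mono (m + n) (d * c)).congr fun t => by rw [ee_add]; ring
  | add f g _ _ hf hg => exact (TP.add _ _ hf hg).congr fun t => by ring

lemma TP.mul {f g : ℝ → ℂ} (h : TP f) (h' : TP g) : TP (fun t => f t * g t) := by
  induction h' with
  | mono m d => exact h.mul_mono m d
  | add u v _ _ hf hg => exact (TP.add _ _ hf hg).congr fun t => by ring

lemma TP.smul {f : ℝ → ℂ} (h : TP f) (c : ℂ) : TP (fun t => c * f t) := (TP.const c).mul h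

lemma TP.contDiff {f : ℝ → ℂ} (h : TP f) : ContDiff ℝ (⊤ : ℕ∞) f := by
  induction h with
  | mono m d => exact contDiff_const.mul (ee_contDiff m)
  | add f g _ _ hf hg => exact hf.add hg

lemma TP.bdd {f : ℝ → ℂ} (h : TP f) : ∃ M : ℝ, 0 < M ∧ ∀ t, ‖f t‖ ≤ M := by
  induction h with
  | mono m d => exact ⟨‖d‖ + 1, by positivity, fun t => by simp [ee_norm]⟩
  | add f g _ _ hf hg =>
    obtain ⟨M, h0, h⟩ := hf
    obtain ⟨M', h0', h'⟩ := hg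
    exact ⟨M + M', by positivity, fun t => (norm_add_le _ _).trans (add_le_add (h t) (h' t))⟩

lemma TP.hasDeriv {f : ℝ → ℂ} (h : TP f) : ∃ g, TP g ∧ ∀ t, HasDerivAt f (g t) t := by
  induction h with
  | mono m d =>
    refine ⟨_, TP.mono m (d * (2 * Real.pi * Complex.I * m)), fun t => ?_⟩
    exact ((ee_deriv m t).const_mul d).congr_deriv (by ring)
  | add f g _ _ hf hg =>
    obtain ⟨M, h0, h⟩ := hf
    obtain ⟨M', h0', h'⟩ := hg
    exact ⟨_, TP.add _ _ h0 h0', fun t => (h t).add (h' t)⟩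

lemma TP.periodic {f : ℝ → ℂ} (h : TP f) : f 1 = f 0 := by
  induction h with
  | mono m d => simp [ee_at_one, ee_at_zero]
  | add f g _ _ hf hg => simp [hf, hg]

/-- Families of functions having small antiderivatives vanishing at both endpoints. -/
def Sm (F : ℕ → ℝ → ℂ) : Prop :=
  ∀ ε : ℝ, 0 < ε → ∃ N : ℕ, ∀ n ≥ N, ∃ h : ℝ → ℂ, (∀ t, HasDerivAt h (F n t) t) ∧
    h 0 = 0 ∧ h 1 = 0 ∧ ∀ t, ‖h t‖ ≤ ε

lemma Sm.add {F G : ℕ → ℝ → ℂ} (hF : Sm F) (hG : Sm G) : Sm (fun n t => F n t + G n t) := by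
  intro ε hε
  obtain ⟨N, hN⟩ := hF (ε / 2) (by positivity)
  obtain ⟨M, hM⟩ := hG (ε / 2) (by positivity)
  refine ⟨max N M, fun n hn => ?_⟩
  obtain ⟨h, h1, h2, h3, h4⟩ := hN n ((le_max_left _ _).trans hn)
  obtain ⟨k, k1, k2, k3, k4⟩ := hM n ((le_max_right _ _).trans hn)
  refine ⟨fun t => h t + k t, fun t => (h1 t).add (k1 t), by simp [h2, k2], by simp [h3, k3],
    fun t => (norm_add_le _ _).trans ?_⟩
  linarith [h4 t, k4 t]

lemma Sm.congr {F G : ℕ → ℝ → ℂ} (hF : Sm F) (e : ∀ n t, F n t = G n t) : Sm G := by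
  have : F = G := by funext n t; exact e n t
  rwa [← this]

lemma TP.sm {g : ℝ → ℂ} (hg : TP g) (k : ℤ) (hk : k ≠ 0) :
    Sm (fun n t => g t * ee (k * n) t) := by
  induction hg with
  | mono m d =>
    intro ε hε
    obtain ⟨N, hN⟩ := exists_nat_gt (‖d‖ * 2 / ε)
    refine ⟨N + m.natAbs + 1, fun n hn => ?_⟩
    set l : ℤ := m + k * n with hl
    have hl1 : (N : ℤ) + 1 ≤ |l| := by
      have h1 : (n : ℤ) ≤ |k * n| := by
        rw [abs_mul, Nat.abs_cast]
        have : 1 ≤ |k| := Int.one_le_abs hk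
        nlinarith
      have h2 : |k * n| ≤ |l| + |m| := by
        have : k * n = l - m := by rw [hl]; ring
        rw [this]; exact abs_sub _ _
      have h3 : ((N + m.natAbs + 1 : ℕ) : ℤ) ≤ n := by exact_mod_cast hn
      push_cast at h3
      linarith
    have hl2 : (N : ℝ) + 1 ≤ |(l : ℝ)| := by exact_mod_cast hl1
    have hl0 : (l : ℂ) ≠ 0 := by
      intro h
      have : l = 0 := by exact_mod_cast h
      rw [this] at hl1; simp at hl1; omega
    have hpi : (Real.pi : ℂ) ≠ 0 := by exact_mod_cast Real.pi_ne_zero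
    refine ⟨fun t => d / (2 * Real.pi * Complex.I * l) * (ee l t - 1), fun t => ?_, ?_, ?_,
      fun t => ?_⟩
    · have := ((ee_deriv l t).sub_const 1).const_mul (d / (2 * Real.pi * Complex.I * l))
      refine this.congr_deriv ?_
      have e : ee l t = ee m t * ee (k * n) t := by rw [hl, ee_add]
      rw [e]
      field_simp [Complex.I_ne_zero]
    · simp [ee_at_zero]
    · simp [ee_at_one]
    · have h1 : ‖ee l t - 1‖ ≤ 2 := by
        refine (norm_sub_le _ _).trans ?_
        rw [ee_norm]; norm_num
      rw [norm_mul, norm_div]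
      have h2 : ‖(2 * Real.pi * Complex.I * l : ℂ)‖ = 2 * Real.pi * |(l : ℝ)| := by
        simp [abs_of_pos Real.pi_pos]
      rw [h2]
      have h3 : (N : ℝ) ≤ 2 * Real.pi * |(l : ℝ)| := by
        have := Real.pi_gt_three
        have h0 := abs_nonneg (l : ℝ)
        nlinarith
      have hN0 : 0 ≤ ‖d‖ * 2 / ε := by positivity
      have h4 : 0 < 2 * Real.pi * |(l : ℝ)| := by linarith
      calc _ ≤ ‖d‖ / (2 * Real.pi * |(l : ℝ)|) * 2 := by gcongr
        _ = ‖d‖ * 2 / (2 * Real.pi * |(l : ℝ)|) := by ring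
        _ ≤ ε := by
          rw [div_le_iff₀ h4]
          rw [div_lt_iff₀ hε] at hN
          nlinarith
  | add f g _ _ hf hg => exact (hf.add hg).congr fun n t => by ring

lemma TP_of_span (F : C(AddCircle (1 : ℝ), ℂ)) (hF : F ∈ Submodule.span ℂ (Set.range (@fourier (1 : ℝ)))) :
    TP (fun t => F (t : AddCircle (1 : ℝ))) := by
  induction hF using Submodule.span_induction with
  | mem x hx =>
    obtain ⟨n, rfl⟩ := hx
    refine (TP.mono n 1).congr fun t => ?_
    rw [fourier_coe_apply]; simp [ee]
  | zero => exact TP.const 0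
  | add x y _ _ hx hy => exact TP.add _ _ hx hy
  | smul a x _ hx => exact TP.smul hx a

lemma TP_approx (f : ℝ → ℂ) (hf : Continuous f) (h0 : f 0 = 0) (h1 : f 1 = 0) (ε : ℝ) (hε : 0 < ε) :
    ∃ g, TP g ∧ g 0 = 0 ∧ ∀ t ∈ Set.Icc (0 : ℝ) 1, ‖g t - f t‖ < ε := by
  have : Fact ((0 : ℝ) < 1) := ⟨one_pos⟩
  let F : C(AddCircle (1 : ℝ), ℂ) := ⟨AddCircle.liftIco 1 0 f,
    AddCircle.liftIco_continuous (by simp [h0, h1]) hf.continuousOn⟩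
  have hF : F ∈ (Submodule.span ℂ (Set.range (@fourier (1 : ℝ)))).topologicalClosure := by
    rw [span_fourier_closure_eq_top]; trivial
  have hF' : F ∈ closure (Submodule.span ℂ (Set.range (@fourier (1 : ℝ))) : Set _) := hF
  rw [Metric.mem_closure_iff] at hF'
  obtain ⟨G, hG, hd⟩ := hF' (ε / 2) (by positivity)
  have hb : ∀ t ∈ Set.Icc (0 : ℝ) 1, ‖G (t : AddCircle (1 : ℝ)) - f t‖ < ε / 2 := by
    intro t ht
    have e : F (t : AddCircle (1 : ℝ)) = f t := by
      rcases eq_or_lt_of_le ht.2 with h | h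
      · subst h
        have : ((1 : ℝ) : AddCircle (1 : ℝ)) = ((0 : ℝ) : AddCircle (1 : ℝ)) := by
          rw [AddCircle.coe_period]; rfl
        rw [this, h1, ← h0]
        exact AddCircle.liftIco_coe_apply (by simp)
      · exact AddCircle.liftIco_coe_apply (by simpa using ⟨ht.1, h⟩)
    rw [← e, ← dist_eq_norm, dist_comm]
    exact (ContinuousMap.dist_apply_le_dist _).trans_lt hd
  refine ⟨_, TP.add _ _ (TP_of_span G hG) (TP.const (-G ((0 : ℝ) : AddCircle (1 : ℝ)))), by simp, ?_⟩
  intro t ht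
  have a := hb t ht
  have b := hb 0 (by simp)
  rw [h0, sub_zero] at b
  have : G (t : AddCircle (1 : ℝ)) + -G ((0 : ℝ) : AddCircle (1 : ℝ)) - f t
    = (G (t : AddCircle (1 : ℝ)) - f t) - G ((0 : ℝ) : AddCircle (1 : ℝ)) := by ring
  rw [this]
  refine (norm_sub_le _ _).trans_lt (by linarith)

/-- The norm in the definition of Sigma. -/
noncomputable def NN (z : ℂ) (u : ℂ × ℂ) : ℝ := eNorm2 ((z * u.1).re, (z * u.2).re)

lemma NN_cont (z : ℂ) : Continuous (NN z) := by
  unfold NN eNorm2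
  fun_prop

lemma NN_smul (z : ℂ) (R : ℝ) (hR : 0 ≤ R) (u : ℂ × ℂ) : NN z (R • u) = R * NN z u := by
  unfold NN eNorm2
  have h1 : (z * (R • u).1).re = R * (z * u.1).re := by simp; ring
  have h2 : (z * (R • u).2).re = R * (z * u.2).re := by simp; ring
  rw [h1, h2]
  simp only
  rw [show (R * (z * u.1).re) ^ 2 + (R * (z * u.2).re) ^ 2
    = R ^ 2 * ((z * u.1).re ^ 2 + (z * u.2).re ^ 2) by ring,
    Real.sqrt_mul (sq_nonneg R), Real.sqrt_sq hR]

lemma NN_pos (z : ℂ) (u : ℂ × ℂ) (h : (z * u.1).re ≠ 0 ∨ (z * u.2).re ≠ 0) : 0 < NN z u := by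
  unfold NN eNorm2
  apply Real.sqrt_pos.2
  rcases h with h | h
  · have := sq_nonneg (z * u.2).re
    positivity
  · have := sq_nonneg (z * u.1).re
    positivity

lemma NN_ne (z : ℂ) (u : ℂ × ℂ) (h : 0 < NN z u) : (z * u.1).re ≠ 0 ∨ (z * u.2).re ≠ 0 := by
  by_contra hc
  push Not at hc
  unfold NN eNorm2 at h
  simp [hc.1, hc.2] at h

/-- The region. -/
def Sg (s : Finset ℂ) (d : ℝ) : Set (ℂ × ℂ) := {u | ∀ z ∈ s, d < NN z u}

lemma Sg_open (s : Finset ℂ) (d : ℝ) : IsOpen (Sg s d) := by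
  have : Sg s d = ⋂ z ∈ s, {u | d < NN z u} := by ext; simp [Sg]
  rw [this]
  exact isOpen_biInter_finset fun z _ => isOpen_lt continuous_const (NN_cont z)

lemma join_scale (s : Finset ℂ) (d : ℝ) (hd : 0 < d) (v : ℂ × ℂ) (hv : v ∈ Sg s d) (R : ℝ)
    (hR : 1 ≤ R) : JoinedIn (Sg s d) v (R • v) := by
  refine JoinedIn.ofLine (f := fun t : ℝ => (1 + t * (R - 1)) • v) (by fun_prop) (by simp)
    (by simp) ?_
  rintro _ ⟨t, ht, rfl⟩ z hz
  have h1 : 1 ≤ 1 + t * (R - 1) := by nlinarith [ht.1]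
  rw [NN_smul _ _ (by linarith)]
  have := hv z hz
  nlinarith

lemma join_seg (s : Finset ℂ) (d : ℝ) (hd : 0 < d) (v u : ℂ × ℂ)
    (h : ∀ t ∈ Set.Icc (0 : ℝ) 1, (1 - t) • v + t • u ∈ Sg s 0) :
    ∃ R0 : ℝ, ∀ R ≥ R0, JoinedIn (Sg s d) (R • v) (R • u) := by
  have hc : ContinuousOn (fun t : ℝ => ∑ z ∈ s, 1 / NN z ((1 - t) • v + t • u)) (Set.Icc 0 1) := by
    refine continuousOn_finsetSum _ fun z hz => ?_
    refine continuousOn_const.div ?_ fun t ht => (h t ht z hz).ne'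
    exact ((NN_cont z).comp (by fun_prop)).continuousOn
  obtain ⟨M, hM⟩ := (isCompact_Icc.image_of_continuousOn hc).bddAbove
  refine ⟨max 1 (d * M + 1), fun R hR => ?_⟩
  have hR1 : 1 ≤ R := (le_max_left _ _).trans hR
  have hR2 : d * M + 1 ≤ R := (le_max_right _ _).trans hR
  refine JoinedIn.ofLine (f := fun t : ℝ => R • ((1 - t) • v + t • u)) (by fun_prop) (by simp)
    (by simp) ?_
  rintro _ ⟨t, ht, rfl⟩ z hz
  rw [NN_smul _ _ (by linarith)]
  have h0 := h t ht z hz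
  have h1 : 1 / NN z ((1 - t) • v + t • u) ≤ M := by
    refine le_trans ?_ (hM ⟨t, ht, rfl⟩)
    exact Finset.single_le_sum (f := fun z => 1 / NN z ((1 - t) • v + t • u))
      (fun y hy => (one_div_pos.2 (h t ht y hy)).le) hz
  rw [div_le_iff₀ h0] at h1
  nlinarith

lemma seg_ok (s : Finset ℂ) (v : ℂ × ℂ) (a : ℂ) (r : ℝ)
    (ha : ∀ z ∈ s, (z * a).re ≠ 0) (hr : ∀ z ∈ s, (z * v.2).re - r * (z * v.1).re ≠ 0) :
    ∀ t ∈ Set.Icc (0 : ℝ) 1, (1 - t) • v + t • ((a, r • a) : ℂ × ℂ) ∈ Sg s 0 := by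
  intro t ht z hz
  apply NN_pos
  by_contra hc
  push Not at hc
  obtain ⟨h1, h2⟩ := hc
  have e1 : (z * ((1 - t) • v + t • ((a, r • a) : ℂ × ℂ)).1).re
    = (1 - t) * (z * v.1).re + t * (z * a).re := by simp; ring
  have e2 : (z * ((1 - t) • v + t • ((a, r • a) : ℂ × ℂ)).2).re
    = (1 - t) * (z * v.2).re + t * r * (z * a).re := by simp; ring
  rw [e1] at h1
  rw [e2] at h2
  have h3 : (1 - t) * ((z * v.2).re - r * (z * v.1).re) = 0 := by linear_combination h2 - r * h1
  have h4 : t = 1 := by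
    rcases mul_eq_zero.1 h3 with h | h
    · linarith
    · exact absurd h (hr z hz)
  subst h4
  simp at h1
  exact ha z hz (by simpa using h1)

lemma Sg_joined (s : Finset ℂ) (hs : ∀ z ∈ s, z ≠ 0) (d : ℝ) (hd : 0 < d) (v w : ℂ × ℂ)
    (hv : v ∈ Sg s d) (hw : w ∈ Sg s d) : JoinedIn (Sg s d) v w := by
  obtain ⟨b, hb⟩ := Infinite.exists_notMem_finset (s.image fun z => z.re / z.im)
  obtain ⟨r, hr⟩ := Infinite.exists_notMem_finset
    ((s.image fun z => (z * v.2).re / (z * v.1).re) ∪ (s.image fun z => (z * w.2).re / (z * w.1).re))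
  rw [Finset.mem_union, not_or] at hr
  have key : ∀ x : ℂ × ℂ, x ∈ Sg s 0 → r ∉ (s.image fun z => (z * x.2).re / (z * x.1).re) →
      ∀ z ∈ s, (z * x.2).re - r * (z * x.1).re ≠ 0 := by
    intro x hx hrx z hz h
    by_cases h0 : (z * x.1).re = 0
    · rcases NN_ne z x (hx z hz) with h' | h'
      · exact h' h0
      · apply h'; rw [h0] at h; linarith
    · apply hrx
      rw [Finset.mem_image]
      exact ⟨z, hz, by rw [div_eq_iff h0]; linarith⟩
  have ha : ∀ z ∈ s, (z * (⟨1, b⟩ : ℂ)).re ≠ 0 := by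
    intro z hz h
    rw [Complex.mul_re] at h
    simp only at h
    by_cases h0 : z.im = 0
    · apply hs z hz
      apply Complex.ext
      · rw [h0] at h; simpa using h
      · simpa using h0
    · apply hb
      rw [Finset.mem_image]
      exact ⟨z, hz, by rw [div_eq_iff h0]; linarith⟩
  have hv0 : v ∈ Sg s 0 := fun z hz => hd.trans (hv z hz)
  have hw0 : w ∈ Sg s 0 := fun z hz => hd.trans (hw z hz)
  obtain ⟨R1, h1⟩ := join_seg s d hd _ _ (seg_ok s v _ r ha (key v hv0 hr.1))
  obtain ⟨R2, h2⟩ := join_seg s d hd _ _ (seg_ok s w _ r ha (key w hw0 hr.2))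
  let R := max 1 (max R1 R2)
  have hR1 : 1 ≤ R := le_max_left _ _
  have a1 := h1 R ((le_max_left _ _).trans (le_max_right _ _))
  have a2 := h2 R ((le_max_right _ _).trans (le_max_right _ _))
  exact ((join_scale s d hd v hv R hR1).trans a1).trans
    (a2.symm.trans (join_scale s d hd w hw R hR1).symm)

lemma core (D1 D2 : ℝ → ℂ) (h1 : TP D1) (h2 : TP D2) (d3 : ℂ) (ε : ℝ) (hε : 0 < ε) :
    ∃ u1 u2 u3 k1 k2 k3 : ℝ → ℂ,
      (ContDiff ℝ (⊤ : ℕ∞) u1 ∧ ContDiff ℝ (⊤ : ℕ∞) u2 ∧ ContDiff ℝ (⊤ : ℕ∞) u3) ∧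
      (∀ t, u1 t ^ 2 + u2 t ^ 2 + u3 t ^ 2 = 0) ∧
      (∀ t, ¬ (u1 t = 0 ∧ u2 t = 0)) ∧
      (∀ t, HasDerivAt k1 (u1 t - D1 t) t) ∧ (∀ t, HasDerivAt k2 (u2 t - D2 t) t) ∧
      (∀ t, HasDerivAt k3 (u3 t - d3) t) ∧
      (k1 0 = 0 ∧ k1 1 = 0) ∧ (k2 0 = 0 ∧ k2 1 = 0) ∧ (k3 0 = 0 ∧ k3 1 = 0) ∧
      (∀ t, ‖k1 t‖ ≤ ε) ∧ (∀ t, ‖k2 t‖ ≤ ε) := by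
  have hP : TP (fun t => D1 t + Complex.I * D2 t) := TP.add _ _ h1 (h2.smul _)
  have hQ : TP (fun t => D1 t + (-Complex.I) * D2 t) := TP.add _ _ h1 (h2.smul _)
  obtain ⟨M, hM0, hM⟩ := hQ.bdd
  let κ : ℝ := M + 1
  have hκ : κ = M + 1 := rfl
  let K : ℂ := (κ : ℂ)
  have hK : K ≠ 0 := by
    have : κ ≠ 0 := by rw [hκ]; positivity
    exact Complex.ofReal_ne_zero.2 this
  have hKn : ‖K‖ = M + 1 := by
    simp only [K, Complex.norm_real, Real.norm_eq_abs]
    rw [hκ, abs_of_pos (by linarith)]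
  obtain ⟨x, hx, hxP⟩ : ∃ x, TP x ∧ ∀ t, 2 * K * x t = D1 t + Complex.I * D2 t :=
    ⟨_, hP.smul (1 / (2 * K)), fun t => by field_simp⟩
  obtain ⟨y, hy, hyQ⟩ : ∃ y, TP y ∧ ∀ t, -(2 * K * y t) = D1 t + (-Complex.I) * D2 t :=
    ⟨_, hQ.smul (-1 / (2 * K)), fun t => by field_simp⟩
  obtain ⟨z, hz⟩ : ∃ z : ℂ, K * z = d3 := ⟨d3 / K, by field_simp⟩
  have hylt : ∀ t, ‖y t‖ < ‖K‖ := by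
    intro t
    have := hM t
    rw [← hyQ, norm_neg, norm_mul, norm_mul, hKn] at this
    rw [hKn]
    simp at this
    nlinarith [norm_nonneg (y t)]
  let a : ℕ → ℝ → ℂ := fun n t => K * ee n t + x t * ee (-n) t + z * ee (-2 * n) t
  let b : ℕ → ℝ → ℂ := fun n t => K * ee (2 * n) t + y t * ee (-2 * n) t
  have E2 : ∀ (n : ℕ) t, ee (2 * n) t = ee n t ^ 2 := fun n t => by
    rw [two_mul, ee_add]; ring
  have E3 : ∀ (n : ℕ) t, ee (3 * n) t = ee n t ^ 3 := fun n t => by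
    rw [show (3 * n : ℤ) = n + n + n by ring, ee_add, ee_add]; ring
  have E4 : ∀ (n : ℕ) t, ee (4 * n) t = ee n t ^ 4 := fun n t => by
    rw [show (4 * n : ℤ) = n + n + n + n by ring, ee_add, ee_add, ee_add]; ring
  have F1 : ∀ (n : ℕ) t, ee (-1 * n) t = ee (-n) t := fun n t => by
    rw [neg_one_mul]
  have G1 : ∀ (n : ℕ) t, ee (1 * n) t = ee n t := fun n t => by
    rw [one_mul]
  have F2 : ∀ (n : ℕ) t, ee (-2 * n) t = ee (-n) t ^ 2 := fun n t => by
    rw [show (-2 * n : ℤ) = -n + -n by ring, ee_add]; ring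
  have F3 : ∀ (n : ℕ) t, ee (-3 * n) t = ee (-n) t ^ 3 := fun n t => by
    rw [show (-3 * n : ℤ) = -n + -n + -n by ring, ee_add, ee_add]; ring
  have F4 : ∀ (n : ℕ) t, ee (-4 * n) t = ee (-n) t ^ 4 := fun n t => by
    rw [show (-4 * n : ℤ) = -n + -n + -n + -n by ring, ee_add, ee_add, ee_add]; ring
  have EF : ∀ (n : ℕ) t, ee n t * ee (-n) t = 1 := fun n t => by
    rw [← ee_add, add_neg_cancel, ee_zero]
  have sp : Sm (fun n t => a n t ^ 2 - (D1 t + Complex.I * D2 t)) := by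
    refine ((((((TP.const (K ^ 2)).sm 2 (by norm_num)).add
      ((TP.const (2 * K * z)).sm (-1) (by norm_num))).add
      ((hx.mul hx).sm (-2) (by norm_num))).add
      ((TP.const (z ^ 2)).sm (-4) (by norm_num))).add
      ((hx.smul (2 * z)).sm (-3) (by norm_num))).congr fun n t => ?_
    simp only [a]
    rw [← hxP, E2, F1, F2, F3, F4]
    linear_combination (-2 * K * x t - 2 * K * z * ee (-n) t) * EF n t
  have sq : Sm (fun n t => -b n t ^ 2 - (D1 t + (-Complex.I) * D2 t)) := by
    refine (((TP.const (-K ^ 2)).sm 4 (by norm_num)).add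
      (((hy.mul hy).smul (-1)).sm (-4) (by norm_num))).congr fun n t => ?_
    simp only [b]
    rw [← hyQ, E2, E4, F2, F4]
    linear_combination (2 * K * y t * (ee n t * ee (-n) t + 1)) * EF n t
  have sr : Sm (fun n t => a n t * b n t - d3) := by
    refine ((((((TP.const (K ^ 2)).sm 3 (by norm_num)).add
      ((hy.smul K).sm (-1) (by norm_num))).add
      ((hx.smul K).sm 1 (by norm_num))).add
      ((hx.mul hy).sm (-3) (by norm_num))).add
      ((hy.smul z).sm (-4) (by norm_num))).congr fun n t => ?_
    simp only [a, b]
    rw [← hz, E2, E3, F1, G1, F2, F3, F4]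
    linear_combination (- K * y t * ee (-n) t - K * x t * ee n t
      - K * z * (ee n t * ee (-n) t + 1)) * EF n t
  obtain ⟨N1, H1⟩ := sp ε hε
  obtain ⟨N2, H2⟩ := sq ε hε
  obtain ⟨N3, H3⟩ := sr ε hε
  let n := N1 + N2 + N3
  obtain ⟨p, p1, p2, p3, p4⟩ := H1 n (by omega)
  obtain ⟨q, q1, q2, q3, q4⟩ := H2 n (by omega)
  obtain ⟨r, r1, r2, r3, -⟩ := H3 n (by omega)
  have ca : ContDiff ℝ (⊤ : ℕ∞) (a n) := by
    have := hx.contDiff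
    have := ee_contDiff n
    have := ee_contDiff (-n)
    have := ee_contDiff (-2 * n)
    simp only [a]
    fun_prop
  have cb : ContDiff ℝ (⊤ : ℕ∞) (b n) := by
    have := hy.contDiff
    have := ee_contDiff (2 * n)
    have := ee_contDiff (-2 * n)
    simp only [b]
    fun_prop
  have hI := Complex.I_sq
  refine ⟨fun t => (1 / 2) * (a n t ^ 2 - b n t ^ 2),
    fun t => (-Complex.I / 2) * (a n t ^ 2 + b n t ^ 2), fun t => a n t * b n t,
    fun t => (1 / 2) * (p t + q t), fun t => (-Complex.I / 2) * (p t - q t), r,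
    ⟨by fun_prop, by fun_prop, by fun_prop⟩, ?_, ?_, ?_, ?_, r1, ?_, ?_, ⟨r2, r3⟩, ?_, ?_⟩
  · intro t
    linear_combination (1 / 4) * (a n t ^ 2 + b n t ^ 2) ^ 2 * hI
  · rintro t ⟨e1, e2⟩
    have hb : b n t ^ 2 = 0 := by
      linear_combination -e1 + Complex.I * e2 + (1 / 2) * (a n t ^ 2 + b n t ^ 2) * hI
    have hb' : b n t = 0 := by simpa using hb
    have : K * ee (2 * n) t = -(y t * ee (-2 * n) t) := by
      simp only [b] at hb'
      linear_combination hb'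
    have h3 := congrArg norm this
    rw [norm_neg, norm_mul, norm_mul, ee_norm, ee_norm] at h3
    linarith [hylt t]
  · intro t
    refine (((p1 t).add (q1 t)).const_mul (1 / 2)).congr_deriv ?_
    ring
  · intro t
    refine (((p1 t).sub (q1 t)).const_mul (-Complex.I / 2)).congr_deriv ?_
    linear_combination D2 t * hI
  · simp [p2, q2, p3, q3]
  · simp [p2, q2, p3, q3]
  · intro t
    have := norm_add_le (p t) (q t)
    rw [norm_mul]
    have e : ‖(1 / 2 : ℂ)‖ = 1 / 2 := by simp
    rw [e]
    linarith [p4 t, q4 t]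
  · intro t
    have := norm_sub_le (p t) (q t)
    rw [norm_mul]
    have e : ‖(-Complex.I / 2 : ℂ)‖ = 1 / 2 := by simp
    rw [e]
    linarith [p4 t, q4 t]


/-- Claim 3.5 (second part): any two points of `ℂ³` projecting into
`Σ = {u ∈ ℂ² : ‖Re (𝔳 u)‖ > δ for all 𝔳 ∈ 𝔷}` can be joined by a smooth curve whose
projection stays in `Σ` and whose derivative is everywhere a nonzero null vector. -/
theorem claim_3_5_second
    (𝔷 : Finset ℂ) (h𝔷 : (𝔷 : Set ℂ) ⊆ Metric.sphere (0 : ℂ) 1)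
    (h𝔷ne : 𝔷.Nonempty) (δ : ℝ) (hδ : 0 < δ)
    (v w : ℂ × ℂ × ℂ)
    (hv : ∀ 𝔳 ∈ 𝔷, eNorm2 ((𝔳 * v.1).re, (𝔳 * v.2.1).re) > δ)
    (hw : ∀ 𝔳 ∈ 𝔷, eNorm2 ((𝔳 * w.1).re, (𝔳 * w.2.1).re) > δ) :
    ∃ c : ℝ → ℂ × ℂ × ℂ, ContDiff ℝ (⊤ : ℕ∞) c ∧ c 0 = v ∧ c 1 = w ∧
      (∀ t ∈ Set.Icc (0 : ℝ) 1,
        ∀ 𝔳 ∈ 𝔷, eNorm2 ((𝔳 * (c t).1).re, (𝔳 * (c t).2.1).re) > δ) ∧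
      (∀ t ∈ Set.Icc (0 : ℝ) 1,
        (deriv c t).1 ^ 2 + (deriv c t).2.1 ^ 2 + (deriv c t).2.2 ^ 2 = 0 ∧
        deriv c t ≠ 0) := by
  have hs : ∀ z ∈ 𝔷, z ≠ 0 := by
    intro z hz h
    have := h𝔷 hz
    simp [h] at this
  obtain ⟨γ, hγ⟩ := Sg_joined 𝔷 hs δ hδ (v.1, v.2.1) (w.1, w.2.1) hv hw
  obtain ⟨ε, hε, hsub⟩ := (isCompact_range γ.continuous).exists_thickening_subset_open
    (Sg_open 𝔷 δ) (by rintro _ ⟨t, rfl⟩; exact hγ t)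
  have hof : Continuous (fun t : ℝ => (t : ℂ)) := Complex.continuous_ofReal
  have hγc : Continuous γ.extend := γ.continuous_extend
  obtain ⟨T1, hT1, hT10, hT1b⟩ := TP_approx
    (fun t => (γ.extend t).1 - (v.1 + (t : ℂ) * (w.1 - v.1))) (by fun_prop)
    (by simp) (by simp) (ε / 2) (by positivity)
  obtain ⟨T2, hT2, hT20, hT2b⟩ := TP_approx
    (fun t => (γ.extend t).2 - (v.2.1 + (t : ℂ) * (w.2.1 - v.2.1))) (by fun_prop)
    (by simp) (by simp) (ε / 2) (by positivity)
  obtain ⟨D1, hD1, hD1'⟩ := hT1.hasDeriv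
  obtain ⟨D2, hD2, hD2'⟩ := hT2.hasDeriv
  obtain ⟨u1, u2, u3, k1, k2, k3, ⟨cu1, cu2, cu3⟩, hnull, hne, hk1, hk2, hk3, ⟨k10, k11⟩,
    ⟨k20, k21⟩, ⟨k30, k31⟩, b1, b2⟩ := core _ _ (TP.add _ _ (TP.const (w.1 - v.1)) hD1)
    (TP.add _ _ (TP.const (w.2.1 - v.2.1)) hD2) (w.2.2 - v.2.2) (ε / 4) (by positivity)
  have hid : ∀ t : ℝ, HasDerivAt (fun t : ℝ => (t : ℂ)) 1 t := fun t => by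
    have := Complex.ofRealCLM.hasDerivAt (x := t)
    exact this
  let c1 : ℝ → ℂ := fun t => v.1 + (t : ℂ) * (w.1 - v.1) + T1 t + k1 t
  let c2 : ℝ → ℂ := fun t => v.2.1 + (t : ℂ) * (w.2.1 - v.2.1) + T2 t + k2 t
  let c3 : ℝ → ℂ := fun t => v.2.2 + (t : ℂ) * (w.2.2 - v.2.2) + k3 t
  have d1 : ∀ t, HasDerivAt c1 (u1 t) t := fun t =>
    (((((hid t).mul_const (w.1 - v.1)).const_add v.1).add (hD1' t)).add (hk1 t)).congr_deriv
      (by ring)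
  have d2 : ∀ t, HasDerivAt c2 (u2 t) t := fun t =>
    (((((hid t).mul_const (w.2.1 - v.2.1)).const_add v.2.1).add (hD2' t)).add (hk2 t)).congr_deriv
      (by ring)
  have d3 : ∀ t, HasDerivAt c3 (u3 t) t := fun t =>
    ((((hid t).mul_const (w.2.2 - v.2.2)).const_add v.2.2).add (hk3 t)).congr_deriv
      (by ring)
  have dc : ∀ t, HasDerivAt (fun t => (c1 t, c2 t, c3 t)) (u1 t, u2 t, u3 t) t := fun t =>
    (d1 t).prodMk ((d2 t).prodMk (d3 t))
  have hderiv : deriv (fun t => (c1 t, c2 t, c3 t)) = fun t => (u1 t, u2 t, u3 t) :=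
    funext fun t => (dc t).deriv
  have hp1 := hT1.periodic
  have hp2 := hT2.periodic
  rw [hT10] at hp1
  rw [hT20] at hp2
  refine ⟨fun t => (c1 t, c2 t, c3 t), ?_, ?_, ?_, ?_, ?_⟩
  · rw [contDiff_infty_iff_deriv]
    refine ⟨fun t => (dc t).differentiableAt, ?_⟩
    rw [hderiv]
    exact cu1.prodMk (cu2.prodMk cu3)
  · simp [c1, c2, c3, hT10, hT20, k10, k20, k30]
  · simp [c1, c2, c3, hp1, hp2, k11, k21, k31]
  · intro t ht z hz
    have hmem : (c1 t, c2 t) ∈ Metric.thickening ε (Set.range γ) := by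
      rw [Metric.mem_thickening_iff]
      refine ⟨γ.extend t, ?_, ?_⟩
      · rw [← γ.extend_range]; exact ⟨t, rfl⟩
      · rw [Prod.dist_eq, max_lt_iff, dist_eq_norm, dist_eq_norm]
        constructor
        · have := norm_add_le (T1 t - ((γ.extend t).1 - (v.1 + (t : ℂ) * (w.1 - v.1)))) (k1 t)
          have e : c1 t - (γ.extend t).1
            = T1 t - ((γ.extend t).1 - (v.1 + (t : ℂ) * (w.1 - v.1))) + k1 t := by
            simp only [c1]; ring
          rw [e]
          linarith [hT1b t ht, b1 t]
        · have := norm_add_le (T2 t - ((γ.extend t).2 - (v.2.1 + (t : ℂ) * (w.2.1 - v.2.1)))) (k2 t)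
          have e : c2 t - (γ.extend t).2
            = T2 t - ((γ.extend t).2 - (v.2.1 + (t : ℂ) * (w.2.1 - v.2.1))) + k2 t := by
            simp only [c2]; ring
          rw [e]
          linarith [hT2b t ht, b2 t]
    exact hsub hmem z hz
  · intro t _
    rw [hderiv]
    refine ⟨hnull t, fun h => hne t ?_⟩
    simp only [Prod.mk_eq_zero] at h
    exact ⟨h.1, h.2.1⟩
end

section
/- Let K be a compact topological space, let F = (F₁,F₂,F₃) : K → ℂ³ be a continuous map, let 𝔷 ⊆ S¹ be a finite nonempty subset, and let r > 0. Then there exists a vector v = (v₁,v₂,v₃) ∈ ℂ³ such that for every P ∈ K and every 𝔳 ∈ 𝔷, ‖(Re(𝔳·(F₁(P) + v₁)), Re(𝔳·(F₂(P) + v₂)))‖ > r. -/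
/-- For any continuous `F : K → ℂ³` on a compact space, finite nonempty `𝔷 ⊆ S¹` and
`r > 0`, there is a translation vector `v ∈ ℂ³` pushing all `𝔳`-projections of `F + v`,
`𝔳 ∈ 𝔷`, outside the ball of radius `r`. -/
theorem exists_translation_outside
    (K : Type) [TopologicalSpace K] [CompactSpace K]
    (F : K → ℂ × ℂ × ℂ) (hF : Continuous F)
    (𝔷 : Finset ℂ) (h𝔷 : (𝔷 : Set ℂ) ⊆ Metric.sphere (0 : ℂ) 1)
    (h𝔷ne : 𝔷.Nonempty) (r : ℝ) (hr : 0 < r) :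
    ∃ v : ℂ × ℂ × ℂ, ∀ P : K, ∀ 𝔳 ∈ 𝔷,
      eNorm2 ((𝔳 * ((F P).1 + v.1)).re, (𝔳 * ((F P).2.1 + v.2.1)).re) > r := by
  obtain ⟨C, hC⟩ := isCompact_univ.exists_bound_of_continuousOn hF.continuousOn
  set D : ℝ := max C 0 with hD
  have hD0 : 0 ≤ D := le_max_right _ _
  refine ⟨(((4 * D + r + 1 : ℝ) : ℂ), ((4 * D + r + 1 : ℝ) : ℂ) * Complex.I, 0), ?_⟩
  intro P w hw
  have hn : ‖w‖ = 1 := by simpa using h𝔷 hw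
  have hab : w.re ^ 2 + w.im ^ 2 = 1 := by
    have h := Complex.sq_norm w
    rw [hn, Complex.normSq_apply] at h
    nlinarith
  have hP : ‖F P‖ ≤ D := (hC P (Set.mem_univ _)).trans (le_max_left _ _)
  have h1 : |(w * (F P).1).re| ≤ D := by
    refine (Complex.abs_re_le_norm _).trans ?_
    rw [norm_mul, hn, one_mul]
    exact (norm_fst_le _).trans hP
  have h2 : |(w * (F P).2.1).re| ≤ D := by
    refine (Complex.abs_re_le_norm _).trans ?_
    rw [norm_mul, hn, one_mul]
    exact ((norm_fst_le _).trans (norm_snd_le _)).trans hP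
  have ha : |w.re| ≤ 1 := (Complex.abs_re_le_norm _).trans hn.le
  have hb : |w.im| ≤ 1 := (Complex.abs_im_le_norm _).trans hn.le
  have e1 : (w * ((F P).1 + ((4 * D + r + 1 : ℝ) : ℂ))).re
      = (w * (F P).1).re + (4 * D + r + 1) * w.re := by
    rw [mul_add, Complex.add_re, Complex.re_mul_ofReal]; ring
  have e2 : (w * ((F P).2.1 + ((4 * D + r + 1 : ℝ) : ℂ) * Complex.I)).re
      = (w * (F P).2.1).re - (4 * D + r + 1) * w.im := by
    rw [mul_add, Complex.add_re, ← mul_assoc, Complex.mul_I_re, Complex.im_mul_ofReal]; ring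
  unfold eNorm2
  simp only [e1, e2]
  generalize (w * (F P).1).re = x at *
  generalize (w * (F P).2.1).re = y at *
  have hxa : |x * w.re| ≤ D := by
    rw [abs_mul]
    simpa using mul_le_mul h1 ha (abs_nonneg _) hD0
  have hyb : |y * w.im| ≤ D := by
    rw [abs_mul]
    simpa using mul_le_mul h2 hb (abs_nonneg _) hD0
  have hxa' := (abs_le.1 hxa).1
  have hyb' := (abs_le.1 hyb).2
  apply Real.lt_sqrt_of_sq_lt
  have key : (x + (4 * D + r + 1) * w.re) ^ 2 + (y - (4 * D + r + 1) * w.im) ^ 2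
      = x ^ 2 + y ^ 2 + (4 * D + r + 1) ^ 2 * (w.re ^ 2 + w.im ^ 2)
        + 2 * (4 * D + r + 1) * (x * w.re - y * w.im) := by ring
  rw [key, hab]
  have h3 : (4 * D + r + 1) * (-2 * D) ≤ (4 * D + r + 1) * (x * w.re - y * w.im) :=
    mul_le_mul_of_nonneg_left (by linarith) (by linarith)
  nlinarith [sq_nonneg x, sq_nonneg y, mul_nonneg hD0 hr.le]
end
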